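/- Let k be a positive integer and let G be a k-connected finite simple graph with n > k vertices. If S is a set of minimum cardinality among all k-forcing sets S of G such that the subgraph induced by V - S is connected, then V - S is a connected k-dominating set of G (i.e., every vertex of S has at least k neighbors in V - S, and V - S induces a connected subgraph). -/

import Mathlib

open Finset SimpleGraph

/-- One round of the `k`-forcing color change rule: to the currently colored set `C` we add
every vertex `w` having a colored neighbor `v` with at most `k` non-colored neighbors. -/
def kForceStep {V : Type*} [Fintype V] [DecidableEq V] (G : SimpleGraph V)
    [DecidableRel G.Adj] (k : ℕ) (C : Finset V) : Finset V :=
  C ∪ Finset.univ.filter (fun w =>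
    ∃ v ∈ C, G.Adj v w ∧ ((G.neighborFinset v) \ C).card ≤ k)

/-- `S` is a `k`-forcing set: iterating the color change rule starting from `S`
eventually colors all vertices. -/
def IsKForcingSet {V : Type*} [Fintype V] [DecidableEq V] (G : SimpleGraph V)
    [DecidableRel G.Adj] (k : ℕ) (S : Finset V) : Prop :=
  (kForceStep G k)^[Fintype.card V] S = Finset.univ

/-- The `k`-forcing number: the minimum cardinality of a `k`-forcing set. -/
noncomputable def kForcingNumber {V : Type*} [Fintype V] [DecidableEq V] (G : SimpleGraph V)
    [DecidableRel G.Adj] (k : ℕ) : ℕ :=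
  sInf {m | ∃ S : Finset V, IsKForcingSet G k S ∧ S.card = m}

/-- `G` is `k`-connected: it has more than `k` vertices and the removal of any set of fewer
than `k` vertices results in a connected (induced) subgraph. -/
def KConnected {V : Type*} [Fintype V] [DecidableEq V] (G : SimpleGraph V) (k : ℕ) : Prop :=
  k < Fintype.card V ∧
    ∀ A : Finset V, A.card < k → (G.induce ((A : Set V)ᶜ)).Connected

/-- `D` is a connected `k`-dominating set: every vertex not in `D` has at least `k` neighbors
in `D`, and the subgraph induced by `D` is connected. -/
def IsConnKDomSet {V : Type*} [Fintype V] [DecidableEq V] (G : SimpleGraph V)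
    [DecidableRel G.Adj] (k : ℕ) (D : Finset V) : Prop :=
  (∀ v : V, v ∉ D → k ≤ ((G.neighborFinset v) ∩ D).card) ∧
    (G.induce (D : Set V)).Connected

/-- The connected `k`-domination number: the minimum cardinality of a connected
`k`-dominating set. -/
noncomputable def connKDomNumber {V : Type*} [Fintype V] [DecidableEq V] (G : SimpleGraph V)
    [DecidableRel G.Adj] (k : ℕ) : ℕ :=
  sInf {m | ∃ D : Finset V, IsConnKDomSet G k D ∧ D.card = m}

section Helpers

theorem induce_insert_connected_of_adj {V : Type*} {G : SimpleGraph V} {s : Set V}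
    (hs : (G.induce s).Connected) {u t : V}
    (ht : t ∈ s) (hut : G.Adj u t) : (G.induce (insert u s)).Connected := by
  have h : insert u s = {u, t} ∪ s := by
    ext x
    simp only [Set.mem_insert_iff, Set.mem_union, Set.mem_singleton_iff]
    constructor
    · tauto
    · rintro ((h | rfl) | h) <;> tauto
  rw [h]
  exact induce_union_connected (induce_pair_connected_of_adj hut).preconnected hs.preconnected
    ⟨t, by simp, ht⟩

variable {V : Type*} [Fintype V] [DecidableEq V]

/-- An inflationary map on finsets of a finite type stabilizes after `Fintype.card V` iterations. -/
theorem map_iterate_card_eq_of_inflationary {f : Finset V → Finset V} (hf : ∀ C, C ⊆ f C)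
    (C : Finset V) : f (f^[Fintype.card V] C) = f^[Fintype.card V] C := by
  have key : ∀ m, f (f^[m] C) = f^[m] C ∨ m ≤ (f^[m] C).card := by
    intro m
    induction m with
    | zero => exact Or.inr (Nat.zero_le _)
    | succ m ih =>
      rw [Function.iterate_succ_apply']
      rcases ih with h | h
      · exact Or.inl (by rw [h, h])
      · by_cases hfix : f^[m] C = f (f^[m] C)
        · exact Or.inl (by rw [← hfix, ← hfix])
        · exact Or.inr
            (h.trans_lt (Finset.card_lt_card ((hf _).ssubset_of_ne hfix)))
  rcases key (Fintype.card V) with h | h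
  · exact h
  · have huniv : f^[Fintype.card V] C = Finset.univ :=
      Finset.eq_univ_of_card _ (le_antisymm (Finset.card_le_univ _) h)
    rw [huniv]
    exact Finset.univ_subset_iff.mp (hf _)

theorem KConnected.connected {G : SimpleGraph V} {k : ℕ} (h : KConnected G k) (hk : 1 ≤ k) :
    G.Connected := by
  have h0 := h.2 ∅ hk
  rw [Finset.coe_empty, Set.compl_empty] at h0
  exact (induceUnivIso G).connected_iff.mp h0

variable (G : SimpleGraph V) [DecidableRel G.Adj] {k : ℕ}

theorem subset_kForceStep (C : Finset V) : C ⊆ kForceStep G k C :=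
  Finset.subset_union_left

theorem kForceStep_mono : Monotone (kForceStep G k) := by
  intro C D hCD w hw
  simp only [kForceStep, Finset.mem_union, Finset.mem_filter, Finset.mem_univ, true_and] at hw ⊢
  rcases hw with hw | ⟨v, hv, hvw, hcard⟩
  · exact Or.inl (hCD hw)
  · exact Or.inr ⟨v, hCD hv, hvw,
      (Finset.card_le_card (Finset.sdiff_subset_sdiff subset_rfl hCD)).trans hcard⟩

variable {G}

/-- A set which forces a `k`-forcing set in one round is itself a `k`-forcing set. -/
theorem IsKForcingSet.of_subset_kForceStep {S T : Finset V} (hS : IsKForcingSet G k S)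
    (h : S ⊆ kForceStep G k T) : IsKForcingSet G k T := by
  have hle := (kForceStep_mono G (k := k)).iterate (Fintype.card V) h
  rw [← Function.iterate_succ_apply, Function.iterate_succ_apply',
    map_iterate_card_eq_of_inflationary (subset_kForceStep G)] at hle
  rw [IsKForcingSet] at hS
  rw [hS] at hle
  exact Finset.univ_subset_iff.mp hle

/-- If `v ∈ S` has fewer than `k` neighbors outside `S`, then any neighbor of `v` can be removed
from the `k`-forcing set `S`. -/
theorem IsKForcingSet.erase {S : Finset V} (hS : IsKForcingSet G k S) {u v : V} (hv : v ∈ S)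
    (hvu : G.Adj v u) (hlow : (G.neighborFinset v ∩ Sᶜ).card < k) :
    IsKForcingSet G k (S.erase u) := by
  refine hS.of_subset_kForceStep fun w hw => ?_
  simp only [kForceStep, Finset.mem_union, Finset.mem_filter, Finset.mem_univ, true_and,
    Finset.mem_erase]
  by_cases hwu : w = u
  · subst hwu
    refine Or.inr ⟨v, ⟨hvu.ne, hv⟩, hvu, ?_⟩
    have hsub : G.neighborFinset v \ S.erase w ⊆ insert w (G.neighborFinset v ∩ Sᶜ) := by
      intro x hx
      simp only [Finset.mem_sdiff, Finset.mem_erase, Finset.mem_insert, Finset.mem_inter,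
        Finset.mem_compl] at hx ⊢
      tauto
    exact (Finset.card_le_card hsub).trans ((Finset.card_insert_le _ _).trans hlow)
  · exact Or.inl ⟨hwu, hw⟩

theorem KConnected.le_degree (h : KConnected G k) (v : V) : k ≤ G.degree v := by
  by_contra! hlt
  have hc := h.2 (G.neighborFinset v) hlt
  obtain ⟨w, hw⟩ : ∃ w, w ∉ insert v (G.neighborFinset v) := by
    by_contra! hall
    have hle := Finset.card_le_card (fun x _ => hall x : Finset.univ ⊆ _)
    have hins := Finset.card_insert_le v (G.neighborFinset v)
    rw [G.card_neighborFinset_eq_degree] at hins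
    rw [Finset.card_univ] at hle
    have := h.1
    omega
  simp only [Finset.mem_insert, mem_neighborFinset, not_or] at hw
  have : Nontrivial ↥((G.neighborFinset v : Set V)ᶜ) :=
    ⟨⟨v, by simp⟩, ⟨w, by simpa using hw.2⟩, fun he => hw.1 (congrArg Subtype.val he).symm⟩
  obtain ⟨⟨x, hx⟩, hvx⟩ := hc.preconnected.exists_adj_of_nontrivial ⟨v, by simp⟩
  exact hx (by simpa using hvx)

end Helpers

/-- Lemma 4: Let `G` be `k`-connected with `n > k` vertices. If `S` has
minimum cardinality among all `k`-forcing sets whose complement induces a connected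
subgraph, then `V - S` is a connected `k`-dominating set of `G`. -/
theorem compl_min_kForcingSet_isConnKDom {V : Type*} [Fintype V] [DecidableEq V]
    (G : SimpleGraph V) [DecidableRel G.Adj] (k : ℕ) (hk : 1 ≤ k)
    (hkconn : KConnected G k) (hn : k < Fintype.card V)
    (S : Finset V) (hS : IsKForcingSet G k S)
    (hSc : (G.induce ((Sᶜ : Finset V) : Set V)).Connected)
    (hmin : ∀ T : Finset V, IsKForcingSet G k T →
      (G.induce ((Tᶜ : Finset V) : Set V)).Connected → S.card ≤ T.card) :
    IsConnKDomSet G k Sᶜ := by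
  refine ⟨fun v hv => ?_, hSc⟩
  have hisolated : ∀ u v : V, v ∈ S → (G.neighborFinset v ∩ Sᶜ).card < k → u ∈ S → G.Adj v u →
      ∀ t, G.Adj u t → t ∈ S := by
    intro u v hv hlow hu hvu t hut
    by_contra ht
    have hconn : (G.induce (((S.erase u)ᶜ : Finset V) : Set V)).Connected := by
      rw [Finset.compl_erase, Finset.coe_insert]
      exact induce_insert_connected_of_adj hSc (by simpa using ht) hut
    exact (Finset.card_erase_lt_of_mem hu).not_ge (hmin _ (hS.erase hv hvu hlow) hconn)
  by_contra! hlow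
  have hvS : v ∈ S := by simpa using hv
  have hempty : ∀ x, (∀ t, G.Adj x t → t ∈ S) → (G.neighborFinset x ∩ Sᶜ).card < k := by
    intro x hx
    have : G.neighborFinset x ∩ Sᶜ = ∅ := by
      ext t
      simpa using hx t
    rw [this]
    exact hk
  have hvt : ∀ t, G.Adj v t → t ∈ S := by
    obtain ⟨u, hu, huS⟩ : ∃ u, G.Adj v u ∧ u ∈ S := by
      by_contra! hall
      have hsub : G.neighborFinset v ⊆ G.neighborFinset v ∩ Sᶜ := fun x hx =>
        Finset.mem_inter.mpr ⟨hx, by simpa using hall x (by simpa using hx)⟩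
      have hle := Finset.card_le_card hsub
      rw [G.card_neighborFinset_eq_degree] at hle
      have := hkconn.le_degree v
      omega
    exact hisolated v u huS (hempty u (hisolated u v hvS hlow huS hu)) hvS hu.symm
  obtain ⟨⟨t, ht⟩⟩ := hSc.nonempty
  obtain ⟨p⟩ := (hkconn.connected hk).preconnected v t
  obtain ⟨d, -, ⟨hd, hdt⟩, hd'⟩ := p.exists_boundary_dart
    {x | x ∈ S ∧ ∀ t, G.Adj x t → t ∈ S} ⟨hvS, hvt⟩
    (fun h => (Finset.mem_compl.mp (Finset.mem_coe.mp ht)) h.1)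
  have hsnd := hdt _ d.adj
  exact hd' ⟨hsnd, hisolated _ _ hd (hempty _ hdt) hsnd d.adj⟩
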